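/- Fix an integer p ≥ 3 and let λ = 2cos(π/p). Let α be a hyperbolic fixed point of the Hecke group G_p with Hecke conjugate α', and suppose α' < 0 < α (α is G_p-simple). Set n = −⌊α'/λ⌋. Then n ≥ 1, the number β = α + nλ satisfies 0 < β' = α' + nλ < λ < β, and β is G_p-reduced: the complete-quotient sequence of the λ-continued fraction of β is purely periodic. -/

import Mathlib

open Real Matrix Filter

noncomputable section

/-- `λ_p = 2 cos (π / p)`, the minimal translation length of the Hecke group `G_p`. -/
def heckeLambda (p : ℕ) : ℝ := 2 * Real.cos (Real.pi / p)

/-- The matrix `S = [[1, λ], [0, 1]]`. -/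
def Smat (l : ℝ) : Matrix (Fin 2) (Fin 2) ℝ := !![1, l; 0, 1]

/-- The matrix `T = [[0, -1], [1, 0]]`. -/
def Tmat : Matrix (Fin 2) (Fin 2) ℝ := !![0, -1; 1, 0]

/-- The matrix `U = S * T = [[λ, -1], [1, 0]]`. -/
def Umat (l : ℝ) : Matrix (Fin 2) (Fin 2) ℝ := !![l, -1; 1, 0]

/-- The matrix `S^r = [[1, rλ], [0, 1]]` for an integer exponent `r`. -/
def SmatZ (l : ℝ) (r : ℤ) : Matrix (Fin 2) (Fin 2) ℝ := !![1, (r : ℝ) * l; 0, 1]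

/-- Möbius (linear fractional) action of a `2 × 2` real matrix on a real number. -/
def mobius (M : Matrix (Fin 2) (Fin 2) ℝ) (x : ℝ) : ℝ :=
  (M 0 0 * x + M 0 1) / (M 1 0 * x + M 1 1)

/-- `U^k(0)`, the image of `0` under `k` iterations of the linear fractional
transformation `U : x ↦ λ - 1/x`; as a ratio of entries of the matrix power `U^k`. -/
def Uorbit (l : ℝ) (k : ℕ) : ℝ := ((Umat l) ^ k) 0 1 / ((Umat l) ^ k) 1 1

/-- The complete quotients `α_j` of the (negative) `λ`-continued fraction algorithm:
`α_0 = α`, `α_{j+1} = 1 / (r_j λ - α_j)` with `r_j = ⌊α_j / λ⌋ + 1`. -/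
def cq (l α : ℝ) : ℕ → ℝ
  | 0 => α
  | j + 1 => 1 / (((⌊cq l α j / l⌋ : ℝ) + 1) * l - cq l α j)

/-- The partial quotients `r_j = ⌊α_j / λ⌋ + 1` of the `λ`-continued fraction of `α`. -/
def pq (l α : ℝ) (j : ℕ) : ℤ := ⌊cq l α j / l⌋ + 1

/-- `S` as an element of `SL(2, ℝ)`. -/
def Sgen (l : ℝ) : Matrix.SpecialLinearGroup (Fin 2) ℝ :=
  ⟨!![1, l; 0, 1], by norm_num [Matrix.det_fin_two_of]⟩

/-- `T` as an element of `SL(2, ℝ)`. -/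
def Tgen : Matrix.SpecialLinearGroup (Fin 2) ℝ :=
  ⟨!![0, -1; 1, 0], by norm_num [Matrix.det_fin_two_of]⟩

/-- The Hecke group `G_p`, the subgroup of `SL(2, ℝ)` generated by `S` and `T`. -/
def heckeGroup (l : ℝ) : Subgroup (Matrix.SpecialLinearGroup (Fin 2) ℝ) :=
  Subgroup.closure {Sgen l, Tgen}

/-- `M = [[a, b], [c, d]]` fixes `α` as a linear fractional transformation, i.e.
`α` is a root of `c x² + (d - a) x - b = 0`. -/
def fixesQuad (M : Matrix.SpecialLinearGroup (Fin 2) ℝ) (α : ℝ) : Prop :=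
  M.1 1 0 * α ^ 2 + (M.1 1 1 - M.1 0 0) * α - M.1 0 1 = 0

/-- `α` is a hyperbolic fixed point of the Hecke group `G(λ)`. -/
def IsHypFixedPt (l α : ℝ) : Prop :=
  ∃ M ∈ heckeGroup l, 2 < |M.1 0 0 + M.1 1 1| ∧ fixesQuad M α

/-- `α` is a hyperbolic fixed point of `G(λ)` with Hecke conjugate `α'`
(the other root of the fixed-point quadratic). -/
def IsHypPair (l α α' : ℝ) : Prop :=
  ∃ M ∈ heckeGroup l, 2 < |M.1 0 0 + M.1 1 1| ∧ fixesQuad M α ∧ fixesQuad M α' ∧ α' ≠ α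

/-- A hyperbolic fixed point is `G_p`-reduced when its complete-quotient sequence is
purely periodic. -/
def GpReduced (l β : ℝ) : Prop :=
  IsHypFixedPt l β ∧ ∃ m, 1 ≤ m ∧ cq l β m = β

/-- The map `Φ_p : [0, ∞) → [0, ∞)`: `Φ_p(x) = T U^i (x)` when
`U^{p-i+1}(0) ≤ x < U^{p-i}(0)` for the (unique) `i` with `1 ≤ i ≤ p - 2`,
and `Φ_p(x) = x - λ` when `x ≥ λ`. -/
def Phi (p : ℕ) (l : ℝ) (x : ℝ) : ℝ :=
  @dite ℝ (∃ i : ℕ, 1 ≤ i ∧ i ≤ p - 2 ∧ Uorbit l (p - i + 1) ≤ x ∧ x < Uorbit l (p - i))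
    (Classical.propDecidable _)
    (fun h => mobius (Tmat * (Umat l) ^ h.choose) x)
    (fun _ => x - l)

/-- `C_{n-j, n}`: the partial convergents computed by downward recursion,
`C_{n,n} = r_n λ` and `C_{m,n} = r_m λ - 1 / C_{m+1,n}`. -/
def convAux (l α : ℝ) (n : ℕ) : ℕ → ℝ
  | 0 => (pq l α n : ℝ) * l
  | j + 1 => (pq l α (n - (j + 1)) : ℝ) * l - 1 / convAux l α n j

/-- The `n`-th convergent `C_n = C_{0,n}` of the `λ`-continued fraction of `α`. -/
def conv (l α : ℝ) (n : ℕ) : ℝ := convAux l α n n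

/-- The word `S^{r_0} T S^{r_1} T ⋯ S^{r_n} T`. -/
def cfWord (l : ℝ) (r : ℕ → ℤ) (n : ℕ) : Matrix (Fin 2) (Fin 2) ℝ :=
  ((List.range (n + 1)).map fun j => SmatZ l (r j) * Tmat).prod

/-- The Chebyshev-type sequence `sin (kπ/p) / sin (π/p)`. -/
def sinRatio (p k : ℕ) : ℝ := Real.sin (k * (Real.pi / p)) / Real.sin (Real.pi / p)

/-- The nonnegative matrix `-U^{k+1} T`; for `k = 0` it is `S`. -/
def posLetter (p k : ℕ) : Matrix (Fin 2) (Fin 2) ℝ :=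
  !![sinRatio p (k + 1), sinRatio p (k + 2); sinRatio p k, sinRatio p (k + 1)]

/-- The product of the matrices `posLetter p k` over a list of indices. -/
def posWord (p : ℕ) (L : List ℕ) : Matrix (Fin 2) (Fin 2) ℝ := (L.map (posLetter p)).prod

section SinRatio

variable {p : ℕ}

theorem sin_pi_div_pos (hp : 3 ≤ p) : 0 < Real.sin (Real.pi / p) := by
  have h3 : (3 : ℝ) ≤ p := by exact_mod_cast hp
  refine Real.sin_pos_of_pos_of_lt_pi (by positivity) ?_
  rw [div_lt_iff₀ (by linarith)]
  nlinarith [Real.pi_pos]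

theorem heckeLambda_pos (hp : 3 ≤ p) : 0 < heckeLambda p := by
  have h3 : (3 : ℝ) ≤ p := by exact_mod_cast hp
  have h0 : 0 < Real.pi / p := by positivity
  have h1 : Real.pi / p < Real.pi / 2 :=
    div_lt_div_of_pos_left Real.pi_pos (by norm_num) (by linarith)
  have := Real.cos_pos_of_mem_Ioo ⟨by linarith, h1⟩
  unfold heckeLambda
  linarith

theorem sinRatio_zero : sinRatio p 0 = 0 := by simp [sinRatio]

theorem sinRatio_one (hp : 3 ≤ p) : sinRatio p 1 = 1 := by
  simp [sinRatio, (sin_pi_div_pos hp).ne']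

theorem sinRatio_add_two (k : ℕ) :
    sinRatio p (k + 2) = heckeLambda p * sinRatio p (k + 1) - sinRatio p k := by
  have h2 : ((k + 2 : ℕ) : ℝ) * (Real.pi / p)
      = ((k + 1 : ℕ) : ℝ) * (Real.pi / p) + Real.pi / p := by
    push_cast; ring
  have h0 : (k : ℝ) * (Real.pi / p) = ((k + 1 : ℕ) : ℝ) * (Real.pi / p) - Real.pi / p := by
    push_cast; ring
  simp only [sinRatio, heckeLambda]
  rw [h2, h0, Real.sin_add, Real.sin_sub]
  ring

theorem sinRatio_pos (hp : 3 ≤ p) {k : ℕ} (h0 : 0 < k) (hk : k < p) : 0 < sinRatio p k := by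
  have hp0 : (0 : ℝ) < p := by exact_mod_cast (by omega : 0 < p)
  have hk0 : (0 : ℝ) < k := by exact_mod_cast h0
  have hkp : (k : ℝ) < p := by exact_mod_cast hk
  refine div_pos (Real.sin_pos_of_pos_of_lt_pi (by positivity) ?_) (sin_pi_div_pos hp)
  rw [← mul_div_assoc, div_lt_iff₀ hp0]
  nlinarith [Real.pi_pos]

theorem sinRatio_self (hp : 3 ≤ p) : sinRatio p p = 0 := by
  have hp0 : (p : ℝ) ≠ 0 := by exact_mod_cast (by omega : p ≠ 0)
  simp [sinRatio, mul_div_cancel₀ _ hp0]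

theorem sinRatio_nonneg (hp : 3 ≤ p) {k : ℕ} (hk : k ≤ p) : 0 ≤ sinRatio p k := by
  rcases Nat.eq_zero_or_pos k with rfl | h0
  · rw [sinRatio_zero]
  · rcases hk.eq_or_lt with rfl | hk
    · rw [sinRatio_self hp]
    · exact (sinRatio_pos hp h0 hk).le

theorem sinRatio_sub (hp : 3 ≤ p) {k : ℕ} (hk : k ≤ p) : sinRatio p (p - k) = sinRatio p k := by
  have hp0 : (p : ℝ) ≠ 0 := by exact_mod_cast (by omega : p ≠ 0)
  have h : ((p - k : ℕ) : ℝ) * (Real.pi / p) = Real.pi - k * (Real.pi / p) := by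
    rw [Nat.cast_sub hk]; field_simp
  rw [sinRatio, h, Real.sin_pi_sub, sinRatio]

theorem sinRatio_pred (hp : 3 ≤ p) : sinRatio p (p - 1) = 1 := by
  rw [sinRatio_sub hp (by omega), sinRatio_one hp]

end SinRatio

section Words

variable {p : ℕ}

theorem posWord_nil : posWord p [] = 1 := rfl

theorem posWord_cons (k : ℕ) (L : List ℕ) : posWord p (k :: L) = posLetter p k * posWord p L := by
  simp [posWord]

theorem posWord_append_singleton (L : List ℕ) (k : ℕ) :
    posWord p (L ++ [k]) = posWord p L * posLetter p k := by
  simp [posWord]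

theorem posLetter_zero (hp : 3 ≤ p) : posLetter p 0 = Smat (heckeLambda p) := by
  simp [posLetter, Smat, sinRatio_add_two, sinRatio_one hp, sinRatio_zero]

theorem posLetter_pred (hp : 3 ≤ p) : posLetter p (p - 1) = Tmat := by
  have h1 : p - 1 + 1 = p := by omega
  have h2 : sinRatio p (p - 1 + 2) = -1 := by
    rw [sinRatio_add_two, h1, sinRatio_self hp, sinRatio_pred hp]; ring
  simp only [posLetter, h1, h2, sinRatio_self hp, sinRatio_pred hp, Tmat]

theorem Umat_mul_posLetter (k : ℕ) :
    Umat (heckeLambda p) * posLetter p k = posLetter p (k + 1) := by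
  simp only [Umat, posLetter, Matrix.mul_fin_two]
  rw [show k + 1 + 2 = (k + 1) + 2 from rfl, sinRatio_add_two (k + 1), sinRatio_add_two k]
  simp [sub_eq_add_neg]

theorem Umat_pow_mul_Smat (hp : 3 ≤ p) :
    Umat (heckeLambda p) ^ (p - 1) * Smat (heckeLambda p) = Tmat := by
  have h : ∀ k, Umat (heckeLambda p) ^ k * posLetter p 0 = posLetter p k := by
    intro k
    induction k with
    | zero => simp
    | succ k ih => rw [pow_succ', Matrix.mul_assoc, ih, Umat_mul_posLetter]
  rw [← posLetter_zero hp, h, posLetter_pred hp]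

theorem Tmat_mul_Tmat : Tmat * Tmat = -1 := by
  ext i j; fin_cases i <;> fin_cases j <;> simp [Tmat]

theorem Umat_eq (l : ℝ) : Umat l = Smat l * Tmat := by
  simp [Umat, Smat, Tmat]

/-- All letters of `L` index nonnegative matrices `posLetter p k` with `k ≤ p - 2`. -/
def Admissible (p : ℕ) (L : List ℕ) : Prop := ∀ k ∈ L, k + 1 < p

/-- Matrices of the form `± A w B` with `A, B ∈ {1, T}` and `w` a word in the `posLetter`s. -/
def IsSignedWord (p : ℕ) (M : Matrix (Fin 2) (Fin 2) ℝ) : Prop :=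
  ∃ L, Admissible p L ∧ ∃ e : ℝ, (e = 1 ∨ e = -1) ∧ ∃ A B : Matrix (Fin 2) (Fin 2) ℝ,
    (A = 1 ∨ A = Tmat) ∧ (B = 1 ∨ B = Tmat) ∧ M = e • (A * posWord p L * B)

theorem IsSignedWord.neg {M : Matrix (Fin 2) (Fin 2) ℝ} (h : IsSignedWord p M) :
    IsSignedWord p (-M) := by
  obtain ⟨L, hL, e, he, A, B, hA, hB, rfl⟩ := h
  refine ⟨L, hL, -e, ?_, A, B, hA, hB, by simp⟩
  rcases he with rfl | rfl <;> simp

theorem IsSignedWord.Tmat_mul {M : Matrix (Fin 2) (Fin 2) ℝ} (h : IsSignedWord p M) :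
    IsSignedWord p (Tmat * M) := by
  obtain ⟨L, hL, e, he, A, B, hA, hB, rfl⟩ := h
  rcases hA with rfl | rfl
  · exact ⟨L, hL, e, he, Tmat, B, Or.inr rfl, hB, by simp [Matrix.mul_assoc]⟩
  · refine ⟨L, hL, -e, by rcases he with rfl | rfl <;> simp, 1, B, Or.inl rfl, hB, ?_⟩
    simp [← Matrix.mul_assoc, Tmat_mul_Tmat]

theorem IsSignedWord.Umat_mul (hp : 3 ≤ p) {M : Matrix (Fin 2) (Fin 2) ℝ}
    (h : IsSignedWord p M) : IsSignedWord p (Umat (heckeLambda p) * M) := by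
  obtain ⟨L, hL, e, he, A, B, hA, hB, rfl⟩ := h
  have he' : -e = 1 ∨ -e = -1 := by rcases he with rfl | rfl <;> simp
  have hcons : Admissible p (0 :: L) := by
    intro k hk
    rcases List.mem_cons.1 hk with rfl | hk
    · omega
    · exact hL k hk
  rcases hA with rfl | rfl
  · cases L with
    | nil =>
      rcases hB with rfl | rfl
      · refine ⟨[0], hcons, e, he, 1, Tmat, Or.inl rfl, Or.inr rfl, ?_⟩
        simp [posWord, posLetter_zero hp, Umat_eq]
      · refine ⟨[0], hcons, -e, he', 1, 1, Or.inl rfl, Or.inl rfl, ?_⟩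
        simp [posWord, posLetter_zero hp, Umat_eq, Matrix.mul_assoc, Tmat_mul_Tmat]
    | cons k L =>
      have hL' : Admissible p L := fun j hj => hL j (List.mem_cons_of_mem _ hj)
      have hk : k + 1 < p := hL k List.mem_cons_self
      rcases (show k + 1 + 1 ≤ p from hk).eq_or_lt with hkp | hkp
      · refine ⟨L, hL', e, he, Tmat, B, Or.inr rfl, hB, ?_⟩
        have hT : posLetter p (k + 1) = Tmat := by
          rw [← posLetter_pred hp]; congr 1; omega
        simp [posWord_cons, ← Matrix.mul_assoc, Umat_mul_posLetter, hT]
      · refine ⟨(k + 1) :: L, ?_, e, he, 1, B, Or.inl rfl, hB, ?_⟩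
        · intro j hj
          rcases List.mem_cons.1 hj with rfl | hj
          · exact hkp
          · exact hL' j hj
        · simp [posWord_cons, ← Matrix.mul_assoc, Umat_mul_posLetter]
  · refine ⟨0 :: L, hcons, -e, he', 1, B, Or.inl rfl, hB, ?_⟩
    have hUT : Umat (heckeLambda p) * Tmat = -Smat (heckeLambda p) := by
      rw [Umat_eq, Matrix.mul_assoc, Tmat_mul_Tmat]; simp
    simp [posWord_cons, ← Matrix.mul_assoc, hUT, posLetter_zero hp]

theorem IsSignedWord.Umat_pow_mul (hp : 3 ≤ p) {M : Matrix (Fin 2) (Fin 2) ℝ}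
    (h : IsSignedWord p M) (k : ℕ) : IsSignedWord p (Umat (heckeLambda p) ^ k * M) := by
  induction k with
  | zero => simpa using h
  | succ k ih => rw [pow_succ', Matrix.mul_assoc]; exact ih.Umat_mul hp

theorem Smat_eq (l : ℝ) : Smat l = -(Umat l * Tmat) := by
  rw [Umat_eq, Matrix.mul_assoc, Tmat_mul_Tmat]; simp

theorem isSignedWord_of_mem_heckeGroup (hp : 3 ≤ p) {M : Matrix.SpecialLinearGroup (Fin 2) ℝ}
    (hM : M ∈ heckeGroup (heckeLambda p)) : IsSignedWord p M.1 := by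
  have hS : (Sgen (heckeLambda p)).1 = Smat (heckeLambda p) := rfl
  have hT : Tgen.1 = Tmat := rfl
  refine Subgroup.closure_induction_left (p := fun M _ => IsSignedWord p M.1) ?_ ?_ ?_ hM
  · exact ⟨[], by simp [Admissible], 1, Or.inl rfl, 1, 1, Or.inl rfl, Or.inl rfl,
      by simp [posWord]⟩
  · rintro x hx y - hy
    rcases hx with rfl | rfl
    · rw [Matrix.SpecialLinearGroup.coe_mul, hS, Smat_eq, Matrix.neg_mul, Matrix.mul_assoc]
      exact (hy.Tmat_mul.Umat_mul hp).neg
    · rw [Matrix.SpecialLinearGroup.coe_mul, hT]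
      exact hy.Tmat_mul
  · rintro x hx y - hy
    rcases hx with rfl | rfl
    · have h : (Sgen (heckeLambda p))⁻¹.1 = -(Tmat * Umat (heckeLambda p) ^ (p - 1)) := by
        have h1 : (Sgen (heckeLambda p)).1 * (Sgen (heckeLambda p))⁻¹.1 = 1 := by
          rw [← Matrix.SpecialLinearGroup.coe_mul]; simp
        have h2 : -(Tmat * Umat (heckeLambda p) ^ (p - 1)) * (Sgen (heckeLambda p)).1 = 1 := by
          rw [hS, Matrix.neg_mul, Matrix.mul_assoc, Umat_pow_mul_Smat hp, Tmat_mul_Tmat, neg_neg]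
        rw [← Matrix.one_mul (Sgen (heckeLambda p))⁻¹.1, ← h2, Matrix.mul_assoc, h1,
          Matrix.mul_one]
      rw [Matrix.SpecialLinearGroup.coe_mul, h, Matrix.neg_mul, Matrix.mul_assoc]
      exact (hy.Umat_pow_mul hp _).Tmat_mul.neg
    · have h : Tgen⁻¹.1 = -Tmat := by
        rw [Matrix.SpecialLinearGroup.coe_inv, hT, Tmat, Matrix.adjugate_fin_two_of]
        simp
      rw [Matrix.SpecialLinearGroup.coe_mul, h, Matrix.neg_mul]
      exact hy.Tmat_mul.neg

theorem posWord_entries (hp : 3 ≤ p) {L : List ℕ} (hL : Admissible p L) :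
    0 < posWord p L 0 0 ∧ 0 ≤ posWord p L 0 1 ∧ 0 ≤ posWord p L 1 0 ∧ 0 < posWord p L 1 1 := by
  induction L with
  | nil => simp [posWord]
  | cons k L ih =>
    obtain ⟨h1, h2, h3, h4⟩ := ih fun j hj => hL j (List.mem_cons_of_mem _ hj)
    have hk : k + 1 < p := hL k List.mem_cons_self
    have s0 := sinRatio_nonneg hp (show k ≤ p by omega)
    have s1 := sinRatio_pos hp (show 0 < k + 1 by omega) hk
    have s2 := sinRatio_nonneg hp (show k + 2 ≤ p by omega)
    simp only [posWord_cons, posLetter, Matrix.mul_apply, Fin.sum_univ_two, Matrix.of_apply,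
      Matrix.cons_val_zero, Matrix.cons_val_one, Matrix.cons_val', Matrix.cons_val_fin_one]
    refine ⟨?_, ?_, ?_, ?_⟩ <;> positivity

theorem posLetter_transpose (hp : 3 ≤ p) {k : ℕ} (hk : k + 1 < p) :
    (posLetter p k)ᵀ = posLetter p (p - 2 - k) := by
  have h0 : p - 2 - k = p - (k + 2) := by omega
  have h1 : p - 2 - k + 1 = p - (k + 1) := by omega
  have h2 : p - 2 - k + 2 = p - k := by omega
  simp only [posLetter, h1, h2]
  rw [h0, sinRatio_sub hp (by omega), sinRatio_sub hp (by omega), sinRatio_sub hp (by omega)]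
  ext i j; fin_cases i <;> fin_cases j <;> rfl

theorem exists_posWord_transpose (hp : 3 ≤ p) {L : List ℕ} (hL : Admissible p L) :
    ∃ L', Admissible p L' ∧ (L ≠ [] → L' ≠ []) ∧ posWord p L' = (posWord p L)ᵀ := by
  induction L with
  | nil => exact ⟨[], hL, id, by simp [posWord]⟩
  | cons k L ih =>
    obtain ⟨L', hL', -, h⟩ := ih fun j hj => hL j (List.mem_cons_of_mem _ hj)
    have hk : k + 1 < p := hL k List.mem_cons_self
    refine ⟨L' ++ [p - 2 - k], ?_, by simp, ?_⟩
    · intro j hj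
      rcases List.mem_append.1 hj with hj | hj
      · exact hL' j hj
      · rw [List.mem_singleton] at hj
        omega
    · rw [posWord_append_singleton, posWord_cons, Matrix.transpose_mul, h,
        posLetter_transpose hp hk]

/-- A hyperbolic pair separated by `0` is fixed by a nonempty word in the nonnegative letters. -/
theorem IsHypPair.exists_posWord (hp : 3 ≤ p) {α α' : ℝ}
    (h : IsHypPair (heckeLambda p) α α') (hneg : α' < 0) (hpos : 0 < α) :
    ∃ L, Admissible p L ∧ L ≠ [] ∧
      (posWord p L 1 0 * α ^ 2 + (posWord p L 1 1 - posWord p L 0 0) * α - posWord p L 0 1 = 0) ∧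
      (posWord p L 1 0 * α' ^ 2 + (posWord p L 1 1 - posWord p L 0 0) * α'
        - posWord p L 0 1 = 0) := by
  obtain ⟨M, hM, htr, hα, hα', -⟩ := h
  obtain ⟨L, hL, e, he, A, B, hA, hB, hMe⟩ := isSignedWord_of_mem_heckeGroup hp hM
  obtain ⟨h1, h2, h3, h4⟩ := posWord_entries hp hL
  obtain ⟨L', hL', hne', hLT⟩ := exists_posWord_transpose hp hL
  unfold fixesQuad at hα hα'
  rw [hMe] at htr hα hα'
  have key : L = [] → posWord p L 0 0 = 1 ∧ posWord p L 1 1 = 1 := by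
    rintro rfl
    simp [posWord]
  suffices h : L ≠ [] ∧ ((posWord p L 1 0 * α ^ 2 + (posWord p L 1 1 - posWord p L 0 0) * α
        - posWord p L 0 1 = 0 ∧
      posWord p L 1 0 * α' ^ 2 + (posWord p L 1 1 - posWord p L 0 0) * α' - posWord p L 0 1 = 0) ∨
      (posWord p L 0 1 * α ^ 2 + (posWord p L 1 1 - posWord p L 0 0) * α - posWord p L 1 0 = 0 ∧
      posWord p L 0 1 * α' ^ 2 + (posWord p L 1 1 - posWord p L 0 0) * α'
        - posWord p L 1 0 = 0)) by
    rcases h with ⟨hne, ⟨g, g'⟩ | ⟨g, g'⟩⟩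
    · exact ⟨L, hL, hne, g, g'⟩
    · exact ⟨L', hL', hne' hne, by simpa [hLT] using g, by simpa [hLT] using g'⟩
  clear hLT
  generalize posWord p L = w at *
  have hw : w = !![w 0 0, w 0 1; w 1 0, w 1 1] := Matrix.eta_fin_two w
  generalize w 0 0 = a at *
  generalize w 0 1 = b at *
  generalize w 1 0 = c at *
  generalize w 1 1 = d at *
  subst hw
  have ht : ∀ x : ℝ, 2 < |x| → x = a + d ∨ x = -(a + d) → L ≠ [] := by
    rintro x hx hxx hnil
    obtain ⟨rfl, rfl⟩ := key hnil
    rcases hxx with rfl | rfl <;> norm_num at hx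
  rcases hA with rfl | rfl <;> rcases hB with rfl | rfl
  · rcases he with rfl | rfl <;> simp at hα hα' htr
    · exact ⟨ht _ htr (Or.inl rfl), Or.inl ⟨hα, hα'⟩⟩
    · exact ⟨ht _ htr (Or.inr (by ring)), Or.inl ⟨by linarith, by linarith⟩⟩
  · exfalso
    rcases he with rfl | rfl <;> simp [Tmat] at hα' <;>
      nlinarith [mul_pos h4 (pow_pos (neg_pos.2 hneg) 2),
        mul_nonneg (add_nonneg h2 h3) (neg_pos.2 hneg).le]
  · exfalso
    rcases he with rfl | rfl <;> simp [Tmat] at hα <;>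
      nlinarith [mul_pos h1 (pow_pos hpos 2), mul_nonneg (add_nonneg h2 h3) hpos.le]
  · rcases he with rfl | rfl <;> simp [Tmat] at hα hα' htr
    · exact ⟨ht _ htr (Or.inr (by ring)), Or.inr ⟨by linarith, by linarith⟩⟩
    · exact ⟨ht _ htr (Or.inl (by ring)), Or.inr ⟨by linarith, by linarith⟩⟩

end Words

theorem IsHypPair.add_lambda {l α α' : ℝ} (h : IsHypPair l α α') :
    IsHypPair l (α + l) (α' + l) := by
  obtain ⟨M, hM, htr, hα, hα', hne⟩ := h
  have hS : Sgen l ∈ heckeGroup l := Subgroup.subset_closure (by simp)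
  have hconj : (Sgen l * M * (Sgen l)⁻¹).1
      = !![M.1 0 0 + l * M.1 1 0, M.1 0 1 + l * M.1 1 1 - l * (M.1 0 0 + l * M.1 1 0);
          M.1 1 0, M.1 1 1 - l * M.1 1 0] := by
    rw [Matrix.SpecialLinearGroup.coe_mul, Matrix.SpecialLinearGroup.coe_mul,
      Matrix.SpecialLinearGroup.coe_inv]
    conv_lhs => rw [Matrix.eta_fin_two M.1]
    simp only [Sgen, Matrix.adjugate_fin_two_of, Matrix.mul_fin_two]
    ext i j; fin_cases i <;> fin_cases j <;> simp <;> ring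
  refine ⟨Sgen l * M * (Sgen l)⁻¹, mul_mem (mul_mem hS hM) (inv_mem hS), ?_, ?_, ?_, ?_⟩
  · rw [hconj]
    simpa using htr
  · unfold fixesQuad at *
    rw [hconj]
    simp
    linear_combination hα
  · unfold fixesQuad at *
    rw [hconj]
    simp
    linear_combination hα'
  · simpa using hne

theorem IsHypPair.add_nat_mul {l α α' : ℝ} (h : IsHypPair l α α') (N : ℕ) :
    IsHypPair l (α + N * l) (α' + N * l) := by
  induction N with
  | zero => simpa using h
  | succ N ih =>
    have := ih.add_lambda
    push_cast
    convert this using 1 <;> ring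

section Quotients

theorem cq_add (l x : ℝ) (a b : ℕ) : cq l x (a + b) = cq l (cq l x a) b := by
  induction b with
  | zero => rfl
  | succ b ih => rw [← Nat.add_assoc, cq, cq, ih]

theorem cq_add_lambda {l : ℝ} (hl : 0 < l) (x : ℝ) (m : ℕ) :
    cq l (x + l) (m + 1) = cq l x (m + 1) := by
  have h : cq l (x + l) 1 = cq l x 1 := by
    simp only [cq, add_div, div_self hl.ne', Int.floor_add_one]
    push_cast
    ring
  rw [Nat.add_comm, cq_add, h, ← cq_add]

theorem cq_one_of_lt {l x : ℝ} (h0 : 0 < x) (hl : x < l) : cq l x 1 = 1 / (l - x) := by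
  have : ⌊x / l⌋ = 0 := by
    rw [Int.floor_eq_zero_iff]
    exact ⟨by have := h0.trans hl; positivity, (div_lt_one (h0.trans hl)).2 hl⟩
  simp [cq, this]

variable {p : ℕ}

theorem mobius_posLetter_zero (hp : 3 ≤ p) (y : ℝ) :
    mobius (posLetter p 0) y = y + heckeLambda p := by
  simp [posLetter_zero hp, mobius, Smat]

theorem cq_mobius_posLetter (hp : 3 ≤ p) {y : ℝ} (hy : 0 < y) (k : ℕ) (hk : k + 1 < p) :
    cq (heckeLambda p) (mobius (posLetter p k) y) k = y + heckeLambda p := by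
  induction k with
  | zero => exact mobius_posLetter_zero hp y
  | succ k ih =>
    have s0 := sinRatio_nonneg hp (show k ≤ p by omega)
    have s1 := sinRatio_pos hp (show 0 < k + 1 by omega) (by omega)
    have s2 := sinRatio_pos hp (show 0 < k + 2 by omega) hk
    have s3 := sinRatio_nonneg hp (show k + 3 ≤ p by omega)
    have hd : 0 < sinRatio p (k + 1) * y + sinRatio p (k + 2) := by positivity
    have hd' : 0 < sinRatio p k * y + sinRatio p (k + 1) := by positivity
    have hsub : heckeLambda p - mobius (posLetter p (k + 1)) y
        = (sinRatio p k * y + sinRatio p (k + 1))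
          / (sinRatio p (k + 1) * y + sinRatio p (k + 2)) := by
      rw [eq_div_iff hd.ne']
      simp [mobius, posLetter]
      rw [sub_mul, div_mul_cancel₀ _ hd.ne', sinRatio_add_two (k + 1)]
      linear_combination -y * sinRatio_add_two (p := p) k
    have hpos : 0 < mobius (posLetter p (k + 1)) y := by
      simp only [mobius, posLetter, Matrix.of_apply, Matrix.cons_val_zero, Matrix.cons_val_one,
        Matrix.cons_val', Matrix.cons_val_fin_one]
      positivity
    have hlt : mobius (posLetter p (k + 1)) y < heckeLambda p := by
      have : 0 < heckeLambda p - mobius (posLetter p (k + 1)) y := by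
        rw [hsub]; positivity
      linarith
    rw [Nat.add_comm k 1, cq_add, Nat.add_comm 1 k, cq_one_of_lt hpos hlt, hsub, one_div_div,
      ← ih (by omega)]
    simp [mobius, posLetter]

theorem mobius_mul {A B : Matrix (Fin 2) (Fin 2) ℝ} {x : ℝ} (h : B 1 0 * x + B 1 1 ≠ 0) :
    mobius (A * B) x = mobius A (mobius B x) := by
  simp only [mobius, Matrix.mul_apply, Fin.sum_univ_two]
  rw [← mul_div_mul_right (A 0 0 * _ + A 0 1) _ h]
  congr 1 <;> field_simp <;> ring

theorem mobius_posWord_cons (hp : 3 ≤ p) {k : ℕ} {L : List ℕ} (hL : Admissible p L) {y : ℝ}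
    (hy : 0 < y) :
    mobius (posWord p (k :: L)) y = mobius (posLetter p k) (mobius (posWord p L) y) := by
  obtain ⟨-, -, h3, h4⟩ := posWord_entries hp hL
  rw [posWord_cons, mobius_mul]
  positivity

theorem mobius_posWord_pos (hp : 3 ≤ p) {L : List ℕ} (hL : Admissible p L) {y : ℝ}
    (hy : 0 < y) : 0 < mobius (posWord p L) y := by
  obtain ⟨h1, h2, h3, h4⟩ := posWord_entries hp hL
  unfold mobius
  positivity

theorem exists_cq_mobius_posWord (hp : 3 ≤ p) {L : List ℕ} {k : ℕ}
    (hL : Admissible p (L ++ [k + 1])) {y : ℝ} (hy : 0 < y) :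
    ∃ m, cq (heckeLambda p) (mobius (posWord p (L ++ [k + 1])) y + heckeLambda p) (m + 1)
      = y + heckeLambda p := by
  have hl := heckeLambda_pos hp
  induction L with
  | nil =>
    refine ⟨k, ?_⟩
    rw [cq_add_lambda hl, List.nil_append, posWord_cons, posWord_nil, Matrix.mul_one]
    exact cq_mobius_posLetter hp hy _ (hL _ (by simp))
  | cons j L ih =>
    have hL' : Admissible p (L ++ [k + 1]) := fun i hi => hL i (List.mem_cons_of_mem _ hi)
    obtain ⟨m, hm⟩ := ih hL'
    rw [List.cons_append, mobius_posWord_cons hp hL' hy]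
    have hx := mobius_posWord_pos hp hL' hy
    cases j with
    | zero =>
      refine ⟨m, ?_⟩
      rw [mobius_posLetter_zero hp, cq_add_lambda hl, hm]
    | succ i =>
      refine ⟨i + 1 + m, ?_⟩
      rw [Nat.add_assoc, cq_add, cq_add_lambda hl, cq_mobius_posLetter hp hx _ (hL _ (by simp)), hm]

end Quotients

/-- A nonnegative word times a letter that moves `(x, 1)`, `x < 0`, into a closed quadrant
`± [0, ∞)²` does not fix `x`. -/
theorem quad_ne_zero_of_quadrant {W V : Matrix (Fin 2) (Fin 2) ℝ} {x e : ℝ} (hx : x < 0)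
    (h00 : 0 < W 0 0) (h01 : 0 ≤ W 0 1) (h10 : 0 ≤ W 1 0)
    (h11 : 0 < W 1 1)
    (hX : 0 ≤ e * (V 0 0 * x + V 0 1)) (hY : 0 ≤ e * (V 1 0 * x + V 1 1))
    (hXY : 0 < e * (V 0 0 * x + V 0 1) ∨ 0 < e * (V 1 0 * x + V 1 1)) :
    (W * V) 1 0 * x ^ 2 + ((W * V) 1 1 - (W * V) 0 0) * x - (W * V) 0 1 ≠ 0 := by
  intro h
  simp only [Matrix.mul_apply, Fin.sum_univ_two] at h
  generalize hXe : e * (V 0 0 * x + V 0 1) = X at *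
  generalize hYe : e * (V 1 0 * x + V 1 1) = Y at *
  have hfix : x * (W 1 0 * X + W 1 1 * Y) = W 0 0 * X + W 0 1 * Y := by
    rw [← hXe, ← hYe]
    linear_combination e * h
  have hx' := neg_pos.2 hx
  rcases hXY with hX' | hY'
  · nlinarith [mul_pos h00 hX', mul_nonneg h01 hY,
      mul_nonneg hx'.le (add_nonneg (mul_nonneg h10 hX) (mul_nonneg h11.le hY))]
  · nlinarith [mul_nonneg h00.le hX, mul_nonneg h01 hY, mul_pos hx' (mul_pos h11 hY'),
      mul_nonneg hx'.le (mul_nonneg h10 hX)]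

theorem IsHypPair.exists_cq_eq {p : ℕ} (hp : 3 ≤ p) {γ γ' : ℝ}
    (h : IsHypPair (heckeLambda p) γ γ') (hpos : 0 < γ) (hneg : γ' < 0)
    (hge : -heckeLambda p ≤ γ') :
    -heckeLambda p < γ' ∧
      ∃ m, cq (heckeLambda p) (γ + heckeLambda p) (m + 1) = γ + heckeLambda p := by
  obtain ⟨L, hL, hne, hγ, hγ'⟩ := h.exists_posWord hp hneg hpos
  obtain ⟨L, k, rfl⟩ := List.eq_nil_or_concat' L |>.resolve_left hne
  have hL' : Admissible p L := fun i hi => hL i (by simp [hi])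
  have hk : k + 1 < p := hL k (by simp)
  obtain ⟨h1, h2, h3, h4⟩ := posWord_entries hp hL'
  cases k with
  | zero =>
    exfalso
    rw [posWord_append_singleton] at hγ'
    refine quad_ne_zero_of_quadrant (e := 1) hneg h1 h2 h3 h4 ?_ ?_ (Or.inr ?_) hγ' <;>
      simp [posLetter_zero hp, Smat]
    linarith
  | succ k =>
    constructor
    · refine lt_of_le_of_ne hge ?_
      rintro rfl
      have s0 := sinRatio_nonneg hp (show k ≤ p by omega)
      have s1 := sinRatio_pos hp (show 0 < k + 1 by omega) (by omega)
      have e2 := sinRatio_add_two (p := p) k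
      have e3 := sinRatio_add_two (p := p) (k + 1)
      rw [posWord_append_singleton] at hγ'
      refine quad_ne_zero_of_quadrant (e := -1) hneg h1 h2 h3 h4 ?_ ?_ (Or.inl ?_) hγ' <;>
        simp [posLetter] <;> linarith
    · obtain ⟨m, hm⟩ := exists_cq_mobius_posWord hp hL hpos
      have hfix : mobius (posWord p (L ++ [k + 1])) γ = γ := by
        obtain ⟨-, -, g3, g4⟩ := posWord_entries hp hL
        rw [mobius, div_eq_iff (by positivity)]
        linear_combination -hγ
      rw [hfix] at hm
      exact ⟨m, hm⟩

/-- if `α` is `G_p`-simple (hyperbolic with conjugate `α' < 0 < α`)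
and `n = -⌊α'/λ⌋`, then `n ≥ 1`, `β = α + nλ` satisfies
`0 < β' = α' + nλ < λ < β`, and `β` is `G_p`-reduced (purely periodic `λ`-CF). -/
theorem hecke_simple_to_reduced (p : ℕ) (hp : 3 ≤ p) (α α' : ℝ)
    (hpair : IsHypPair (heckeLambda p) α α') (hneg : α' < 0) (hpos : 0 < α)
    (n : ℤ) (hn : n = -⌊α' / heckeLambda p⌋) :
    1 ≤ n ∧ 0 < α' + n * heckeLambda p ∧
      α' + n * heckeLambda p < heckeLambda p ∧
      heckeLambda p < α + n * heckeLambda p ∧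
      ∃ m : ℕ, 1 ≤ m ∧
        cq (heckeLambda p) (α + n * heckeLambda p) m = α + n * heckeLambda p := by
  have hl := heckeLambda_pos hp
  have hn1 : 1 ≤ n := by
    have : ⌊α' / heckeLambda p⌋ < 0 := by
      rw [Int.floor_lt]
      simpa using div_neg_of_neg_of_pos hneg hl
    omega
  obtain ⟨N, rfl⟩ : ∃ N : ℕ, n = N + 1 := ⟨(n - 1).toNat, by omega⟩
  have hfl : ((⌊α' / heckeLambda p⌋ : ℤ) : ℝ) = -(N + 1) := by
    have : ⌊α' / heckeLambda p⌋ = -((N : ℤ) + 1) := by omega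
    rw [this]
    push_cast
    ring
  have hle := Int.floor_le (α' / heckeLambda p)
  have hlt := Int.lt_floor_add_one (α' / heckeLambda p)
  rw [hfl] at hle hlt
  rw [le_div_iff₀ hl] at hle
  rw [div_lt_iff₀ hl] at hlt
  have hN : 0 ≤ (N : ℝ) * heckeLambda p := by positivity
  obtain ⟨hgt, m, hm⟩ := (hpair.add_nat_mul N).exists_cq_eq hp (by linarith) (by linarith)
    (by linarith)
  have hβ : α + ((N : ℤ) + 1 : ℤ) * heckeLambda p = α + N * heckeLambda p + heckeLambda p := by
    push_cast
    ring
  have hβ' : α' + ((N : ℤ) + 1 : ℤ) * heckeLambda p = α' + N * heckeLambda p + heckeLambda p := by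
    push_cast
    ring
  rw [hβ, hβ']
  exact ⟨hn1, by linarith, by linarith, by linarith, m + 1, by omega, hm⟩
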